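/- For every ε > 0 there exists a constant c > 0 with the following property. Let A, B ⊆ ℝ be finite sets with A nonempty and let G ⊆ A × B satisfy |G| ≥ |A|^(3/2 + ε). Then max{|A +_G B|, |A ·_G B|} ≥ c · |G|^(1/2 + ε'), where ε' = 4ε / (24 + 16ε). -/

import Mathlib

open Finset in
theorem card_le_card_add_card_collisions {α κ : Type*} [DecidableEq α] [DecidableEq κ]
    (T : Finset α) (f : α → κ) (K : Finset κ) (hf : ∀ t ∈ T, f t ∈ K) :
    T.card ≤ K.card + (T.offDiag.filter (fun q => f q.1 = f q.2)).card := by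
  classical
  rcases T.eq_empty_or_nonempty with rfl | ⟨t₀, -⟩
  · simp
  have : Nonempty α := ⟨t₀⟩
  set rep : κ → α := Function.invFunOn f (T : Set α) with hrep
  have hmem : ∀ t ∈ T, rep (f t) ∈ T := fun t ht => by
    have : ∃ a ∈ (T : Set α), f a = f t := ⟨t, ht, rfl⟩
    exact Function.invFunOn_mem this
  have heq : ∀ t ∈ T, f (rep (f t)) = f t := fun t ht => by
    have : ∃ a ∈ (T : Set α), f a = f t := ⟨t, ht, rfl⟩
    exact Function.invFunOn_eq this
  rw [← card_filter_add_card_filter_not (s := T) (fun t => t = rep (f t))]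
  refine Nat.add_le_add ?_ ?_
  · refine card_le_card_of_injOn f (fun t ht => hf t (mem_filter.1 ht).1) ?_
    intro t ht t' ht' h
    rw [(mem_filter.1 ht).2, (mem_filter.1 ht').2, h]
  · refine card_le_card_of_injOn (fun t => (t, rep (f t))) ?_ ?_
    · intro t ht
      obtain ⟨h1, h2⟩ := mem_filter.1 ht
      exact mem_filter.2 ⟨mem_offDiag.2 ⟨h1, hmem t h1, h2⟩, (heq t h1).symm⟩
    · intro t _ t' _ h
      exact congrArg Prod.fst h

/-- The index of the block of `k` consecutive elements of `P` in which `x` lies. -/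
noncomputable def blockIndex (P : Finset ℝ) (k : ℕ) (x : ℝ) : ℕ :=
  (P.filter (· < x)).card / k

theorem blockIndex_mono (P : Finset ℝ) (k : ℕ) : Monotone (blockIndex P k) := by
  intro x y hxy
  refine Nat.div_le_div_right (Finset.card_le_card fun z hz => ?_)
  simp only [Finset.mem_filter] at hz ⊢
  exact ⟨hz.1, hz.2.trans_le hxy⟩

theorem blockIndex_le (P : Finset ℝ) (k : ℕ) (x : ℝ) : blockIndex P k x ≤ P.card / k :=
  Nat.div_le_div_right (Finset.card_filter_le _ _)

open Finset in
theorem card_filter_lt_injOn (P : Finset ℝ) :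
    Set.InjOn (fun x => (P.filter (· < x)).card) (P : Set ℝ) := by
  have key : ∀ x ∈ P, ∀ y ∈ P, x < y → (P.filter (· < x)).card < (P.filter (· < y)).card := by
    intro x hx y _ hxy
    refine card_lt_card ⟨fun z hz => ?_, fun h => ?_⟩
    · simp only [mem_filter] at hz ⊢
      exact ⟨hz.1, hz.2.trans hxy⟩
    · have := h (mem_filter.2 ⟨hx, hxy⟩)
      simp at this
  intro x hx y hy h
  by_contra hne
  rcases lt_or_gt_of_ne hne with hlt | hlt
  · exact (key x hx y hy hlt).ne h
  · exact (key y hy x hx hlt).ne h.symm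

open Finset in
theorem card_same_block_le (P : Finset ℝ) {k : ℕ} (hk : 0 < k) :
    ((P ×ˢ P).filter (fun q => blockIndex P k q.1 = blockIndex P k q.2)).card ≤ P.card * k := by
  have : P.card * k = (P ×ˢ range k).card := by simp
  rw [this]
  refine card_le_card_of_injOn (fun q => (q.1, (P.filter (· < q.2)).card % k)) ?_ ?_
  · intro q hq
    rw [mem_coe, mem_filter, mem_product] at hq
    exact mem_product.2 ⟨hq.1.1, mem_range.2 (Nat.mod_lt _ hk)⟩
  · rintro ⟨x, y⟩ hq ⟨x', y'⟩ hq' h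
    rw [mem_coe, mem_filter, mem_product] at hq hq'
    simp only [blockIndex] at hq hq'
    simp only [Prod.mk.injEq] at h
    obtain ⟨rfl, h⟩ := h
    have hy : y = y' := by
      refine card_filter_lt_injOn P hq.1.2 hq'.1.2 ?_
      change (P.filter (· < y)).card = (P.filter (· < y')).card
      rw [← Nat.div_add_mod (P.filter (· < y)).card k,
        ← Nat.div_add_mod (P.filter (· < y')).card k, h, ← hq.2, ← hq'.2]
    rw [hy]

/-- The sign of the slope of `a ↦ a * (s - a)` at `a`, with the value `1` at the vertex. -/
noncomputable def slopeSign (s a : ℝ) : ℤ := if 2 * a ≤ s then 1 else -1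

theorem slopeSign_mul_blockIndex_le (P : Finset ℝ) (k : ℕ) {a b a' b' : ℝ}
    (hs : a + b = a' + b') (hσ : slopeSign (a + b) a = slopeSign (a' + b') a') (h : a ≤ a') :
    slopeSign (a + b) a * (blockIndex P k (a * b) : ℤ) ≤
      slopeSign (a' + b') a' * (blockIndex P k (a' * b') : ℤ) := by
  rw [hσ]
  rw [hs] at hσ
  obtain rfl : b = a' + b' - a := by linarith
  unfold slopeSign at *
  by_cases h' : 2 * a' ≤ a' + b'
  · have := blockIndex_mono P k (show a * (a' + b' - a) ≤ a' * b' by nlinarith)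
    simp only [h', if_true, one_mul]
    exact_mod_cast this
  · have h1 : ¬ 2 * a ≤ a' + b' := by
      intro h1
      simp [h', h1] at hσ
    have := blockIndex_mono P k (show a' * b' ≤ a * (a' + b' - a) by nlinarith)
    simp only [h', if_false]
    have : (blockIndex P k (a' * b') : ℤ) ≤ blockIndex P k (a * (a' + b' - a)) := by
      exact_mod_cast this
    linarith

theorem blockIndex_eq_of_sum_eq (P : Finset ℝ) (k : ℕ) {a b c a' b' c' : ℝ}
    (hs : a + b = a' + b') (ht : a + c = a' + c')
    (hσ : slopeSign (a + b) a = slopeSign (a' + b') a')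
    (hτ : slopeSign (a + c) a = slopeSign (a' + c') a')
    (h : slopeSign (a + b) a * (blockIndex P k (a * b) : ℤ) +
          slopeSign (a + c) a * (blockIndex P k (a * c) : ℤ) =
        slopeSign (a' + b') a' * (blockIndex P k (a' * b') : ℤ) +
          slopeSign (a' + c') a' * (blockIndex P k (a' * c') : ℤ)) :
    blockIndex P k (a * b) = blockIndex P k (a' * b') ∧
      blockIndex P k (a * c) = blockIndex P k (a' * c') := by
  have h1 : slopeSign (a + b) a * (blockIndex P k (a * b) : ℤ) =
        slopeSign (a' + b') a' * (blockIndex P k (a' * b') : ℤ) ∧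
      slopeSign (a + c) a * (blockIndex P k (a * c) : ℤ) =
        slopeSign (a' + c') a' * (blockIndex P k (a' * c') : ℤ) := by
    rcases le_total a a' with hle | hle
    · have := slopeSign_mul_blockIndex_le P k hs hσ hle
      have := slopeSign_mul_blockIndex_le P k ht hτ hle
      constructor <;> linarith
    · have := slopeSign_mul_blockIndex_le P k hs.symm hσ.symm hle
      have := slopeSign_mul_blockIndex_le P k ht.symm hτ.symm hle
      constructor <;> linarith
  have hne : ∀ s x, slopeSign s x ≠ 0 := fun s x => by
    unfold slopeSign; split_ifs <;> decide
  rw [hσ, hτ] at h1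
  exact ⟨by exact_mod_cast mul_left_cancel₀ (hne _ _) h1.1,
    by exact_mod_cast mul_left_cancel₀ (hne _ _) h1.2⟩

/-- Two points on the parametrised curve `a ↦ (a * (s - a), a * (s' - a))` with `s' < s`
determine the curve together with the two parameters. -/
theorem eq_of_products_eq {a b c x y z a' b' c' x' y' z' : ℝ}
    (ha : a' ≠ 0) (hx : x' ≠ 0) (hne : a' ≠ x') (hcb : c < b) (hcb' : c' < b')
    (h1 : a + b = x + y) (h2 : a + c = x + z) (h1' : a' + b' = x' + y') (h2' : a' + c' = x' + z')
    (e1 : a * b = a' * b') (e2 : a * c = a' * c') (e3 : x * y = x' * y') (e4 : x * z = x' * z') :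
    a = a' ∧ b = b' ∧ c = c' ∧ x = x' ∧ y = y' ∧ z = z' := by
  obtain rfl : y = a + b - x := by linarith
  obtain rfl : z = a + c - x := by linarith
  obtain rfl : y' = a' + b' - x' := by linarith
  obtain rfl : z' = a' + c' - x' := by linarith
  have hu : 0 < b - c := sub_pos.2 hcb
  have hu' : 0 < b' - c' := sub_pos.2 hcb'
  obtain ⟨l, hl⟩ : ∃ l, l = (b' - c') / (b - c) := ⟨_, rfl⟩
  have hl0 : 0 < l := hl ▸ div_pos hu' hu
  have hl' : b' - c' = l * (b - c) := by rw [hl]; field_simp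
  have ea : a = l * a' := by
    have : (a - l * a') * (b - c) = 0 := by linear_combination e1 - e2 + a' * hl'
    rcases mul_eq_zero.1 this with h | h
    · linarith
    · exact absurd h hu.ne'
  have ex : x = l * x' := by
    have : (x - l * x') * (b - c) = 0 := by linear_combination e3 - e4 + x' * hl'
    rcases mul_eq_zero.1 this with h | h
    · linarith
    · exact absurd h hu.ne'
  have fb : l * b = b' := by
    refine mul_left_cancel₀ ha ?_
    rw [← e1, ea]; ring
  have fy : l * (a + b - x) = a' + b' - x' := by
    refine mul_left_cancel₀ hx ?_
    rw [← e3, ex]; ring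
  have hl1 : l = 1 := by
    have : (a' - x') * ((l - 1) * (l + 1)) = 0 := by
      rw [ea, ex] at fy
      linear_combination fy - fb
    rcases mul_eq_zero.1 this with h | h
    · exact absurd (sub_eq_zero.1 h) hne
    · rcases mul_eq_zero.1 h with h | h <;> linarith
  subst hl1
  have hc : b' - c' = b - c := by linarith
  refine ⟨by linarith, by linarith, by linarith, by linarith, by linarith, by linarith⟩

/-- Pairs of edges `((a, b), (a, c))` of `G` with a common first vertex and `c < b`. -/
noncomputable def cherries (G : Finset (ℝ × ℝ)) : Finset ((ℝ × ℝ) × (ℝ × ℝ)) :=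
  (G ×ˢ G).filter (fun q => q.1.1 = q.2.1 ∧ q.2.2 < q.1.2)

theorem mem_cherries {G : Finset (ℝ × ℝ)} {q : (ℝ × ℝ) × (ℝ × ℝ)} :
    q ∈ cherries G ↔ (q.1 ∈ G ∧ q.2 ∈ G) ∧ q.1.1 = q.2.1 ∧ q.2.2 < q.1.2 := by
  simp [cherries]

open Finset in
theorem card_cherries_le (G : Finset (ℝ × ℝ)) (S P : Finset ℝ) (h0 : ∀ e ∈ G, e.1 ≠ 0)
    (hS : ∀ e ∈ G, e.1 + e.2 ∈ S) (hP : ∀ e ∈ G, e.1 * e.2 ∈ P) {k : ℕ} (hk : 0 < k) :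
    (cherries G).card ≤ S.card * S.card * (4 * (4 * (P.card / k) + 1)) + (P.card * k) ^ 2 := by
  classical
  set β := blockIndex P k with hβ
  set R := P.card / k with hR
  let f : (ℝ × ℝ) × (ℝ × ℝ) → (ℝ × ℝ) × ((ℤ × ℤ) × ℤ) := fun q =>
    ((q.1.1 + q.1.2, q.2.1 + q.2.2),
      ((slopeSign (q.1.1 + q.1.2) q.1.1, slopeSign (q.2.1 + q.2.2) q.2.1),
        slopeSign (q.1.1 + q.1.2) q.1.1 * (β (q.1.1 * q.1.2) : ℤ) +
          slopeSign (q.2.1 + q.2.2) q.2.1 * (β (q.2.1 * q.2.2) : ℤ)))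
  let K : Finset ((ℝ × ℝ) × ((ℤ × ℤ) × ℤ)) :=
    (S ×ˢ S) ×ˢ ((({1, -1} : Finset ℤ) ×ˢ ({1, -1} : Finset ℤ)) ×ˢ
      Finset.Icc (-(2 * R : ℤ)) (2 * R))
  have hK : K.card = S.card * S.card * (4 * (4 * R + 1)) := by
    simp only [K, card_product, Int.card_Icc]
    congr 2
    omega
  have hf : ∀ t ∈ cherries G, f t ∈ K := by
    rintro ⟨⟨a, b⟩, ⟨a', c⟩⟩ ht
    obtain ⟨⟨h1, h2⟩, -⟩ := mem_cherries.1 ht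
    have hσ : ∀ s x, slopeSign s x = 1 ∨ slopeSign s x = -1 := fun s x => by
      unfold slopeSign; split_ifs <;> simp
    have b1 : (β (a * b) : ℤ) ≤ R := by exact_mod_cast blockIndex_le P k _
    have b2 : (β (a' * c) : ℤ) ≤ R := by exact_mod_cast blockIndex_le P k _
    have hs1 := hS _ h1
    have hs2 := hS _ h2
    simp only [f, K, mem_product, mem_insert, mem_singleton, Finset.mem_Icc]
    refine ⟨⟨hs1, hs2⟩, ⟨hσ _ _, hσ _ _⟩, ?_⟩
    rcases hσ (a + b) a with h | h <;> rcases hσ (a' + c) a' with h' | h' <;> rw [h, h'] <;>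
      constructor <;> omega
  refine (card_le_card_add_card_collisions (cherries G) f K hf).trans ?_
  rw [hK]
  refine Nat.add_le_add_left ?_ _
  set D := (P ×ˢ P).filter (fun q => blockIndex P k q.1 = blockIndex P k q.2) with hD
  have hDc : (D ×ˢ D).card ≤ (P.card * k) ^ 2 := by
    rw [card_product, sq]
    exact Nat.mul_le_mul (card_same_block_le P hk) (card_same_block_le P hk)
  refine le_trans ?_ hDc
  have split : ∀ q ∈ (cherries G).offDiag.filter (fun q => f q.1 = f q.2),
      ∃ a b c x y z, q = (((a, b), (a, c)), ((x, y), (x, z))) ∧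
        (a, b) ∈ G ∧ (a, c) ∈ G ∧ (x, y) ∈ G ∧ (x, z) ∈ G ∧ c < b ∧ a ≠ x ∧
        a + b = x + y ∧ a + c = x + z ∧
        β (a * b) = β (x * y) ∧ β (a * c) = β (x * z) := by
    rintro ⟨⟨⟨a, b⟩, ⟨a', c⟩⟩, ⟨⟨x, y⟩, ⟨x', z⟩⟩⟩ hq
    obtain ⟨hq, hfq⟩ := mem_filter.1 hq
    obtain ⟨ht, ht', hne⟩ := mem_offDiag.1 hq
    obtain ⟨⟨g1, g2⟩, haa, hlt⟩ := mem_cherries.1 ht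
    obtain ⟨⟨g3, g4⟩, hxx, -⟩ := mem_cherries.1 ht'
    dsimp only at g1 g2 g3 g4 haa hxx hlt hne
    subst haa hxx
    simp only [f, Prod.mk.injEq] at hfq
    obtain ⟨⟨s1, s2⟩, ⟨t1, t2⟩, e⟩ := hfq
    obtain ⟨r1, r2⟩ := blockIndex_eq_of_sum_eq P k s1 s2 t1 t2 e
    refine ⟨a, b, c, x, y, z, rfl, g1, g2, g3, g4, hlt, ?_, s1, s2, r1, r2⟩
    rintro rfl
    exact hne (by rw [add_left_cancel s1, add_left_cancel s2])
  refine card_le_card_of_injOn (fun q =>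
    ((q.1.1.1 * q.1.1.2, q.2.1.1 * q.2.1.2), (q.1.2.1 * q.1.2.2, q.2.2.1 * q.2.2.2))) ?_ ?_
  · intro q hq
    obtain ⟨a, b, c, x, y, z, rfl, g1, g2, g3, g4, -, -, -, -, r1, r2⟩ := split q hq
    simp only [coe_product, Set.mem_prod, hD, coe_filter, mem_product, Set.mem_ofPred_eq]
    exact ⟨⟨⟨hP _ g1, hP _ g3⟩, r1⟩, ⟨⟨hP _ g2, hP _ g4⟩, r2⟩⟩
  · intro q hq q' hq' h
    obtain ⟨a, b, c, x, y, z, rfl, -, -, -, -, hlt, -, h1, h2, -, -⟩ := split q hq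
    obtain ⟨a', b', c', x', y', z', rfl, g1, -, g3, -, hlt', hne', h1', h2', -, -⟩ := split q' hq'
    simp only [Prod.mk.injEq] at h
    obtain ⟨⟨e1, e3⟩, e2, e4⟩ := h
    obtain ⟨rfl, rfl, rfl, rfl, rfl, rfl⟩ :=
      eq_of_products_eq (h0 _ g1) (h0 _ g3) hne' hlt hlt' h1 h2 h1' h2' e1 e2 e3 e4
    rfl

open Finset in
theorem card_le_two_mul_card_mul_card (G : Finset (ℝ × ℝ)) (S P : Finset ℝ)
    (hS : ∀ e ∈ G, e.1 + e.2 ∈ S) (hP : ∀ e ∈ G, e.1 * e.2 ∈ P) :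
    G.card ≤ 2 * (S.card * P.card) := by
  have : 2 * (S.card * P.card) = ((univ : Finset Bool) ×ˢ (S ×ˢ P)).card := by simp
  rw [this]
  refine card_le_card_of_injOn (fun e => (decide (e.1 ≤ e.2), (e.1 + e.2, e.1 * e.2))) ?_ ?_
  · intro e he
    simp [hS e he, hP e he, le_or_gt]
  · rintro ⟨a, b⟩ - ⟨c, d⟩ - h
    simp only [Prod.mk.injEq, decide_eq_decide] at h
    obtain ⟨h1, h2, h3⟩ := h
    have hcases : (a - c) * (a - d) = 0 := by linear_combination a * h2 - h3
    rcases mul_eq_zero.1 hcases with h | h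
    · obtain rfl : a = c := by linarith
      obtain rfl : b = d := by linarith
      rfl
    · obtain rfl : a = d := by linarith
      obtain rfl : b = c := by linarith
      have : a = b := by
        rcases le_total a b with h | h
        · exact le_antisymm h (h1.1 h)
        · exact le_antisymm (h1.2 h) h
      rw [this]

open Finset in
theorem sq_card_le_card_mul_card_cherries (A : Finset ℝ) (G : Finset (ℝ × ℝ))
    (hA : ∀ e ∈ G, e.1 ∈ A) :
    G.card ^ 2 ≤ A.card * (G.card + 2 * (cherries G).card) := by
  classical
  have h1 : G.card = ∑ a ∈ A, (G.filter (fun e => e.1 = a)).card :=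
    card_eq_sum_card_fiberwise hA
  have h2 : ∑ a ∈ A, (G.filter (fun e => e.1 = a)).card ^ 2 =
      ((G ×ˢ G).filter (fun q => q.1.1 = q.2.1)).card := by
    rw [card_eq_sum_card_fiberwise (f := fun q : (ℝ × ℝ) × (ℝ × ℝ) => q.1.1) (t := A)]
    · refine sum_congr rfl fun a _ => ?_
      rw [sq, ← card_product]
      congr 1
      ext q
      simp only [mem_product, mem_filter]
      constructor
      · rintro ⟨⟨h1, h2⟩, h3, h4⟩
        exact ⟨⟨⟨h1, h3⟩, h2.trans h4.symm⟩, h2⟩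
      · rintro ⟨⟨⟨h1, h3⟩, h⟩, h2⟩
        exact ⟨⟨h1, h2⟩, h3, h ▸ h2⟩
    · intro q hq
      exact hA _ (mem_product.1 (mem_filter.1 hq).1).1
  have h3 : (G ×ˢ G).filter (fun q => q.1.1 = q.2.1) ⊆
      G.diag ∪ (cherries G ∪ (cherries G).image Prod.swap) := by
    rintro ⟨⟨a, b⟩, ⟨a', c⟩⟩ hq
    simp only [mem_filter, mem_product] at hq
    obtain ⟨⟨g1, g2⟩, rfl⟩ := hq
    simp only [mem_union, mem_image]
    rcases lt_trichotomy b c with h | rfl | h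
    · exact Or.inr (Or.inr ⟨((a, c), (a, b)), mem_cherries.2 ⟨⟨g2, g1⟩, rfl, h⟩, rfl⟩)
    · exact Or.inl (mem_diag.2 ⟨g1, rfl⟩)
    · exact Or.inr (Or.inl (mem_cherries.2 ⟨⟨g1, g2⟩, rfl, h⟩))
  have h4 : ((G ×ˢ G).filter (fun q => q.1.1 = q.2.1)).card ≤
      G.card + 2 * (cherries G).card := by
    refine (card_le_card h3).trans ((card_union_le _ _).trans ?_)
    rw [diag_card, two_mul]
    exact Nat.add_le_add_left ((card_union_le _ _).trans
      (Nat.add_le_add_left card_image_le _)) _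
  calc G.card ^ 2 = (∑ a ∈ A, (G.filter (fun e => e.1 = a)).card) ^ 2 := by rw [← h1]
    _ ≤ A.card * ∑ a ∈ A, (G.filter (fun e => e.1 = a)).card ^ 2 := sq_sum_le_card_mul_sum_sq
    _ ≤ _ := by rw [h2]; exact Nat.mul_le_mul_left _ h4

open Finset in
theorem card_filter_fst_eq_zero_le (G : Finset (ℝ × ℝ)) (S : Finset ℝ)
    (hS : ∀ e ∈ G, e.1 + e.2 ∈ S) : (G.filter (fun e => ¬ e.1 ≠ 0)).card ≤ S.card := by
  refine card_le_card_of_injOn (fun e => e.1 + e.2) (fun e he => hS e (mem_filter.1 he).1) ?_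
  rintro ⟨a, b⟩ h ⟨c, d⟩ h' e
  simp only [coe_filter, Set.mem_ofPred_eq, not_not] at h h' e
  obtain ⟨-, rfl⟩ := h
  obtain ⟨-, rfl⟩ := h'
  simpa using e

open Finset in
theorem sq_card_le_mul_rpow (A : Finset ℝ) (G : Finset (ℝ × ℝ)) (S P : Finset ℝ)
    (hA : ∀ e ∈ G, e.1 ∈ A) (hS : ∀ e ∈ G, e.1 + e.2 ∈ S) (hP : ∀ e ∈ G, e.1 * e.2 ∈ P)
    {M : ℕ} (hSM : S.card ≤ M) (hPM : P.card ≤ M) :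
    (G.card : ℝ) ^ 2 ≤ 200 * A.card * (M : ℝ) ^ ((8 : ℝ) / 3) := by
  classical
  rcases G.eq_empty_or_nonempty with rfl | ⟨e₀, he₀⟩
  · simp; positivity
  have hA1 : 1 ≤ A.card := card_pos.2 ⟨_, hA _ he₀⟩
  have hM1 : 1 ≤ M := le_trans (card_pos.2 ⟨_, hS _ he₀⟩) hSM
  have hA1' : (1 : ℝ) ≤ A.card := by exact_mod_cast hA1
  have hM1' : (1 : ℝ) ≤ M := by exact_mod_cast hM1
  set G' := G.filter (fun e => e.1 ≠ 0) with hG'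
  have hsub : ∀ e ∈ G', e ∈ G := fun e he => (mem_filter.1 he).1
  set y : ℝ := (M : ℝ) ^ ((1 : ℝ) / 3) with hy
  have hy1 : 1 ≤ y := Real.one_le_rpow hM1' (by norm_num)
  have hy3 : y ^ 3 = M := by
    rw [hy, ← Real.rpow_natCast, ← Real.rpow_mul (by positivity)]; norm_num
  have hy8 : (M : ℝ) ^ ((8 : ℝ) / 3) = y ^ 8 := by
    rw [hy, ← Real.rpow_natCast, ← Real.rpow_mul (by positivity)]; norm_num
  set k := ⌈y⌉₊ with hk
  have hky : y ≤ k := Nat.le_ceil y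
  have hk2 : (k : ℝ) ≤ 2 * y := by
    have := Nat.ceil_lt_add_one (zero_le_one.trans hy1)
    linarith
  have hk0 : 0 < k := Nat.ceil_pos.2 (by linarith)
  have hR : ((M / k : ℕ) : ℝ) ≤ y ^ 2 := by
    refine Nat.cast_div_le.trans ?_
    rw [div_le_iff₀ (by exact_mod_cast hk0), ← hy3]
    nlinarith [sq_nonneg y]
  have hT : (cherries G').card ≤ M * M * (4 * (4 * (M / k) + 1)) + (M * k) ^ 2 := by
    refine (card_cherries_le G' S P (fun e he => (mem_filter.1 he).2)
      (fun e he => hS e (hsub e he)) (fun e he => hP e (hsub e he)) hk0).trans ?_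
    gcongr
  have hT' : ((cherries G').card : ℝ) ≤ 24 * y ^ 8 := by
    have h1 : ((cherries G').card : ℝ) ≤
        M * M * (4 * (4 * ((M / k : ℕ) : ℝ) + 1)) + (M * k) ^ 2 := by exact_mod_cast hT
    have h2 : (1 : ℝ) ≤ y ^ 2 := one_le_pow₀ hy1
    calc ((cherries G').card : ℝ) ≤ _ := h1
      _ ≤ M * M * (4 * (4 * y ^ 2 + y ^ 2)) + (M * (2 * y)) ^ 2 := by gcongr
      _ = 24 * y ^ 8 := by rw [← hy3]; ring
  have hG2 : (G'.card : ℝ) ≤ 2 * y ^ 8 := by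
    have h1 : G'.card ≤ 2 * (M * M) :=
      (card_le_two_mul_card_mul_card G' S P (fun e he => hS e (hsub e he))
        (fun e he => hP e (hsub e he))).trans (by gcongr)
    have h2 : (G'.card : ℝ) ≤ 2 * (M * M) := by exact_mod_cast h1
    have h3 : y ^ 6 ≤ y ^ 8 := pow_le_pow_right₀ hy1 (by norm_num)
    rw [← hy3] at h2
    nlinarith
  have hsq : (G'.card : ℝ) ^ 2 ≤ A.card * (50 * y ^ 8) := by
    have h1 : (G'.card : ℝ) ^ 2 ≤ A.card * (G'.card + 2 * (cherries G').card) := by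
      exact_mod_cast sq_card_le_card_mul_card_cherries A G' (fun e he => hA e (hsub e he))
    refine h1.trans ?_
    gcongr
    linarith
  have hsplit : (G.card : ℝ) ≤ G'.card + y ^ 3 := by
    have h1 : G'.card + (G.filter (fun e => ¬ e.1 ≠ 0)).card = G.card :=
      card_filter_add_card_filter_not (s := G) (fun e => e.1 ≠ 0)
    have h2 := (card_filter_fst_eq_zero_le G S hS).trans hSM
    rw [hy3]
    exact_mod_cast (by omega : G.card ≤ G'.card + M)
  have h6 : (y ^ 3) ^ 2 ≤ A.card * y ^ 8 := by
    have h3 : y ^ 6 ≤ y ^ 8 := pow_le_pow_right₀ hy1 (by norm_num)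
    have h4 : y ^ 8 ≤ A.card * y ^ 8 := le_mul_of_one_le_left (by positivity) hA1'
    calc (y ^ 3) ^ 2 = y ^ 6 := by ring
      _ ≤ _ := h3.trans h4
  rw [hy8]
  calc (G.card : ℝ) ^ 2 ≤ (G'.card + y ^ 3) ^ 2 := by gcongr
    _ ≤ 2 * ((G'.card : ℝ) ^ 2 + (y ^ 3) ^ 2) := add_sq_le
    _ ≤ 2 * (A.card * (50 * y ^ 8) + A.card * y ^ 8) := by gcongr
    _ ≤ 200 * A.card * y ^ 8 := by
      have : 0 ≤ (A.card : ℝ) * y ^ 8 := by positivity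
      nlinarith

/-- Nontrivial sum-product growth for `|G| ≥ |A|^(3/2+ε)`: for every `ε > 0`
there is `c > 0` such that whenever `A` is nonempty, `G ⊆ A × B` and
`|G| ≥ |A|^(3/2+ε)`, we have `max {|A +_G B|, |A ·_G B|} ≥ c · |G|^(1/2+ε')`
with `ε' = 4ε/(24+16ε)`. -/
theorem sum_product_graphs_nontrivial (ε : ℝ) (hε : 0 < ε) :
    ∃ c : ℝ, 0 < c ∧
      ∀ (A B : Finset ℝ) (G : Finset (ℝ × ℝ)), A.Nonempty → G ⊆ A ×ˢ B →
        (A.card : ℝ) ^ ((3 : ℝ) / 2 + ε) ≤ (G.card : ℝ) →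
        c * (G.card : ℝ) ^ ((1 : ℝ) / 2 + 4 * ε / (24 + 16 * ε)) ≤
          ((max (G.image (fun p => p.1 + p.2)).card
                (G.image (fun p => p.1 * p.2)).card : ℕ) : ℝ) := by
  refine ⟨((200 : ℝ) ^ ((3 : ℝ) / 8))⁻¹, by positivity, fun A B G hA hG hcard => ?_⟩
  set M := max (G.image (fun p => p.1 + p.2)).card (G.image (fun p => p.1 * p.2)).card with hM
  have hmain := sq_card_le_mul_rpow A G (G.image (fun p => p.1 + p.2))
    (G.image (fun p => p.1 * p.2)) (fun e he => (Finset.mem_product.1 (hG he)).1)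
    (fun e he => Finset.mem_image_of_mem _ he) (fun e he => Finset.mem_image_of_mem _ he)
    (le_max_left _ _) (le_max_right _ _)
  rw [← hM] at hmain
  have hA1 : (1 : ℝ) ≤ A.card := by exact_mod_cast hA.card_pos
  set g : ℝ := (G.card : ℝ) with hg
  have hg1 : 1 ≤ g := (Real.one_le_rpow hA1 (by positivity)).trans hcard
  have hg0 : 0 < g := by linarith
  set t : ℝ := 2 / (3 + 2 * ε) with ht
  have hAg : (A.card : ℝ) ≤ g ^ t := by
    have h1 := Real.rpow_le_rpow (by positivity) hcard (show 0 ≤ t by positivity)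
    rw [← Real.rpow_mul (by positivity)] at h1
    have h2 : ((3 : ℝ) / 2 + ε) * t = 1 := by rw [ht]; field_simp
    rwa [h2, Real.rpow_one] at h1
  have h1 : g ^ (2 - t) ≤ 200 * (M : ℝ) ^ ((8 : ℝ) / 3) := by
    rw [Real.rpow_sub hg0, div_le_iff₀ (by positivity), Real.rpow_two]
    refine hmain.trans ?_
    have : 200 * (A.card : ℝ) * (M : ℝ) ^ ((8 : ℝ) / 3) ≤ 200 * g ^ t * (M : ℝ) ^ ((8 : ℝ) / 3) := by
      gcongr
    linarith
  have h2 := Real.rpow_le_rpow (by positivity) h1 (show (0 : ℝ) ≤ 3 / 8 by norm_num)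
  rw [Real.mul_rpow (by norm_num) (by positivity), ← Real.rpow_mul hg0.le,
    ← Real.rpow_mul (by positivity)] at h2
  have h3 : (2 - t) * (3 / 8) = (1 : ℝ) / 2 + 4 * ε / (24 + 16 * ε) := by
    rw [ht]
    have h : (24 + 16 * ε) = 8 * (3 + 2 * ε) := by ring
    rw [h]
    field_simp
    ring
  rw [h3, show (8 : ℝ) / 3 * (3 / 8) = 1 by norm_num, Real.rpow_one] at h2
  rw [inv_mul_le_iff₀ (by positivity)]
  exact h2
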